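/- arXiv:2304.01455 — 3 statements merged into one kernel-verified Lean document; each statement's English description precedes it below -/
import Mathlib

section
/- There is an absolute constant C > 0 such that for all Schwartz functions f, g, h on ℝ and every ξ ∈ ℝ, ∬_{ℝ²} |η|^{1/5} |σ|^{1/5} |(F₂^{-1} G_ξ[f,g,h])(η,σ)| dη dσ ≤ C ‖⟨x⟩f‖_{L²(ℝ)} ‖⟨x⟩g‖_{L²(ℝ)} ‖⟨x⟩h‖_{L²(ℝ)}. -/
noncomputable section
open MeasureTheory Complex Real Filter Set ENNReal

/-- 1D Fourier transform with convention `(2π)^{-1/2} ∫ e^{-ixξ} f(x) dx`. -/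
def ft (f : ℝ → ℂ) (ξ : ℝ) : ℂ :=
  (((2 * π) ^ (-(1:ℝ)/2) : ℝ) : ℂ) * ∫ x : ℝ, Complex.exp (-(Complex.I * x * ξ)) * f x

/-- 1D inverse Fourier transform. -/
def ift (f : ℝ → ℂ) (x : ℝ) : ℂ :=
  (((2 * π) ^ (-(1:ℝ)/2) : ℝ) : ℂ) * ∫ ξ : ℝ, Complex.exp (Complex.I * x * ξ) * f ξ

/-- The Schrödinger group `e^{itΔ} f = 𝓕⁻¹ (e^{-itξ²} 𝓕 f)`. -/
def schrodinger (t : ℝ) (f : ℝ → ℂ) : ℝ → ℂ :=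
  ift fun ξ => Complex.exp (-(Complex.I * t * ξ ^ 2)) * ft f ξ

/-- Japanese bracket `⟨x⟩ = (1+x²)^{1/2}`. -/
def jb (x : ℝ) : ℝ := Real.sqrt (1 + x ^ 2)

/-- Inverse Fourier transform on `ℝ²` with convention `(2π)^{-1} ∫ e^{ip·q} G(q) dq`. -/
def ift2 (G : ℝ × ℝ → ℂ) (p : ℝ × ℝ) : ℂ :=
  (((2 * π)⁻¹ : ℝ) : ℂ) * ∫ q : ℝ × ℝ, Complex.exp (Complex.I * (p.1 * q.1 + p.2 * q.2)) * G q

/-- The trilinear kernel `G_ξ[f,g,h](η,σ) = f̂(ξ-η) (ḡ)^(η-ξ+σ) ĥ(ξ-σ)`. -/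
def Gker (f g h : ℝ → ℂ) (ξ : ℝ) (p : ℝ × ℝ) : ℂ :=
  ft f (ξ - p.1) * ft (fun x => (starRingEnd ℂ) (g x)) (p.1 - ξ + p.2) * ft h (ξ - p.2)

open scoped FourierTransform

theorem ft_eq_fourier (f : ℝ → ℂ) (ξ : ℝ) :
    ft f ξ = (((2 * π) ^ (-(1:ℝ)/2) : ℝ) : ℂ) * 𝓕 f (ξ / (2 * π)) := by
  rw [ft, Real.fourier_real_eq_integral_exp_smul]
  congr 1
  refine integral_congr_ae (Eventually.of_forall fun x => ?_)
  simp only [smul_eq_mul]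
  congr 2
  have : (π : ℂ) ≠ 0 := by exact_mod_cast Real.pi_ne_zero
  push_cast
  field_simp

theorem continuous_ft (f : SchwartzMap ℝ ℂ) : Continuous (ft f) := by
  have h : ft f = fun ξ => (((2 * π) ^ (-(1:ℝ)/2) : ℝ) : ℂ) * (𝓕 f) (ξ / (2 * π)) := by
    funext ξ
    rw [ft_eq_fourier, SchwartzMap.fourier_coe]
  rw [h]
  exact continuous_const.mul ((𝓕 f).continuous.comp (by fun_prop))

theorem integrable_ft (f : SchwartzMap ℝ ℂ) : Integrable (ft f) := by
  have h : ft f = fun ξ => (((2 * π) ^ (-(1:ℝ)/2) : ℝ) : ℂ) * (𝓕 f) (ξ / (2 * π)) := by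
    funext ξ
    rw [ft_eq_fourier, SchwartzMap.fourier_coe]
  rw [h]
  exact ((𝓕 f).integrable.comp_div (by positivity)).const_mul _

theorem integral_exp_mul_ft (f : SchwartzMap ℝ ℂ) (x : ℝ) :
    ∫ u : ℝ, Complex.exp (I * x * u) * ft f u =
      ((2 * π * (2 * π) ^ (-(1:ℝ)/2) : ℝ) : ℂ) * f x := by
  have hinv : 𝓕⁻ (𝓕 (f : ℝ → ℂ)) x = f x := by
    rw [f.continuous.fourierInv_fourier_eq f.integrable]
    rw [← SchwartzMap.fourier_coe]
    exact (𝓕 f).integrable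
  have hchange := Measure.integral_comp_div
    (fun v : ℝ => Complex.exp (((2 * π * (v * x) : ℝ) : ℂ) * I) * 𝓕 (f : ℝ → ℂ) v) (2 * π)
  rw [Real.fourierInv_eq'] at hinv
  have hinner : ∫ v : ℝ, Complex.exp (((2 * π * (v * x) : ℝ) : ℂ) * I) * 𝓕 (f : ℝ → ℂ) v
      = f x := by
    rw [← hinv]
    refine integral_congr_ae (Eventually.of_forall fun v => ?_)
    simp [mul_comm]
  rw [hinner, abs_of_pos (by positivity)] at hchange
  calc ∫ u : ℝ, Complex.exp (I * x * u) * ft f u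
      = ∫ u : ℝ, (((2 * π) ^ (-(1:ℝ)/2) : ℝ) : ℂ) *
          (Complex.exp (((2 * π * (u / (2 * π) * x) : ℝ) : ℂ) * I) *
            𝓕 (f : ℝ → ℂ) (u / (2 * π))) := by
        refine integral_congr_ae (Eventually.of_forall fun u => ?_)
        simp only [ft_eq_fourier]
        have h : 2 * π * (u / (2 * π) * x) = x * u := by
          field_simp
        rw [h]
        have h' : I * (x : ℂ) * u = ((x * u : ℝ) : ℂ) * I := by
          push_cast
          ring
        rw [h']
        ring
    _ = _ := by
        rw [integral_const_mul, hchange, Complex.real_smul]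
        push_cast
        ring

theorem norm_integral_exp_mul_ft_sub (f : SchwartzMap ℝ ℂ) (t ξ : ℝ) :
    ‖∫ u : ℝ, Complex.exp (I * t * u) * ft f (ξ - u)‖ =
      2 * π * (2 * π) ^ (-(1:ℝ)/2) * ‖f (-t)‖ := by
  rw [← integral_sub_left_eq_self (μ := volume)
    (fun u : ℝ => Complex.exp (I * t * u) * ft f (ξ - u)) ξ]
  simp only [_root_.sub_sub_cancel]
  have h : ∀ u : ℝ, Complex.exp (I * t * ((ξ - u : ℝ) : ℂ)) * ft f u =
      Complex.exp (I * ((t * ξ : ℝ) : ℂ)) *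
        (Complex.exp (I * ((-t : ℝ) : ℂ) * u) * ft f u) := by
    intro u
    rw [← mul_assoc, ← Complex.exp_add]
    congr 2
    push_cast
    ring
  simp_rw [h]
  rw [integral_const_mul, integral_exp_mul_ft, norm_mul, Complex.norm_exp_I_mul_ofReal, one_mul, norm_mul,
    Complex.norm_real, Real.norm_of_nonneg (by positivity)]

/-- The inverse Fourier transform of the trilinear kernel is dominated by a trilinear convolution. -/
theorem enorm_ift2_Gker_le : ∃ K : ℝ≥0∞, K ≠ ⊤ ∧ ∀ (f g h : SchwartzMap ℝ ℂ) (ξ a b : ℝ),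
    ‖ift2 (Gker f g h ξ) (a, b)‖ₑ ≤ K * ∫⁻ y, ‖g y‖ₑ * (‖f (y - a)‖ₑ * ‖h (y - b)‖ₑ) := by
  set c : ℝ := (2 * π) ^ (-(1:ℝ)/2) with hc
  have hc0 : 0 < c := by positivity
  refine ⟨‖((2 * π)⁻¹ : ℝ)‖ₑ * (‖c‖ₑ * (‖2 * π * c‖ₑ * ‖2 * π * c‖ₑ)), by
    finiteness, fun f g h ξ a b => ?_⟩
  set Φ : ℝ × ℝ → ℝ → ℂ := fun q y =>
    Complex.exp (I * ((y * ξ : ℝ) : ℂ)) * (starRingEnd ℂ) (g y) *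
      ((Complex.exp (I * ((a - y : ℝ) : ℂ) * q.1) * ft f (ξ - q.1)) *
        (Complex.exp (I * ((b - y : ℝ) : ℂ) * q.2) * ft h (ξ - q.2))) with hΦ
  have hcf := continuous_ft f
  have hch := continuous_ft h
  have hΦint : Integrable (Function.uncurry Φ) ((volume : Measure (ℝ × ℝ)).prod volume) := by
    have h0 : Integrable (fun z : (ℝ × ℝ) × ℝ => (ft f (ξ - z.1.1) * ft h (ξ - z.1.2)) * g z.2)
        ((volume : Measure (ℝ × ℝ)).prod volume) :=
      (((integrable_ft f).comp_sub_left ξ).mul_prod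
        ((integrable_ft h).comp_sub_left ξ)).mul_prod g.integrable
    refine h0.mono ?_ (Eventually.of_forall fun z => le_of_eq ?_)
    · apply Continuous.aestronglyMeasurable
      simp only [hΦ, Function.uncurry_def]
      have := g.continuous
      have := Complex.continuous_conj
      fun_prop
    · have e : ∀ s t : ℝ, ‖Complex.exp (I * s * t)‖ = 1 := fun s t => by
        rw [mul_assoc, ← Complex.ofReal_mul, Complex.norm_exp_I_mul_ofReal]
      simp only [hΦ, Function.uncurry_def, norm_mul, e, Complex.norm_exp_I_mul_ofReal, one_mul,
        RCLike.norm_conj]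
      ring
  have hswap : ∫ q : ℝ × ℝ, Complex.exp (I * (a * q.1 + b * q.2)) * Gker f g h ξ q =
      c * ∫ y, ∫ q, Φ q y := by
    rw [← integral_integral_swap hΦint, ← integral_const_mul]
    refine integral_congr_ae (Eventually.of_forall fun q => ?_)
    simp only [Gker]
    rw [ft.eq_def (fun x => (starRingEnd ℂ) (g x)), ← hc]
    have : ∫ y, Φ q y = (Complex.exp (I * (a * q.1 + b * q.2)) *
        (ft f (ξ - q.1) * ft h (ξ - q.2))) *
        ∫ x : ℝ, Complex.exp (-(I * x * ((q.1 - ξ + q.2 : ℝ) : ℂ))) * (starRingEnd ℂ) (g x) := by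
      rw [← integral_const_mul]
      refine integral_congr_ae (Eventually.of_forall fun y => ?_)
      simp only [hΦ]
      have he : Complex.exp (I * ((y * ξ : ℝ) : ℂ)) * Complex.exp (I * ((a - y : ℝ) : ℂ) * q.1) *
          Complex.exp (I * ((b - y : ℝ) : ℂ) * q.2) = Complex.exp (I * (a * q.1 + b * q.2)) *
          Complex.exp (-(I * y * ((q.1 - ξ + q.2 : ℝ) : ℂ))) := by
        rw [← Complex.exp_add, ← Complex.exp_add, ← Complex.exp_add]
        congr 1
        push_cast
        ring
      linear_combination ((starRingEnd ℂ) (g y) * ft f (ξ - q.1) * ft h (ξ - q.2)) * he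
    rw [this]
    ring
  have hinner : ∀ y, ‖∫ q, Φ q y‖ₑ =
      (‖2 * π * c‖ₑ * ‖2 * π * c‖ₑ) * (‖g y‖ₑ * (‖f (y - a)‖ₑ * ‖h (y - b)‖ₑ)) := by
    intro y
    have e1 : ∫ q, Φ q y = Complex.exp (I * ((y * ξ : ℝ) : ℂ)) * (starRingEnd ℂ) (g y) *
      ((∫ u : ℝ, Complex.exp (I * ((a - y : ℝ) : ℂ) * u) * ft f (ξ - u)) *
        ∫ u : ℝ, Complex.exp (I * ((b - y : ℝ) : ℂ) * u) * ft h (ξ - u)) := by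
      rw [← integral_prod_mul, ← integral_const_mul]
      rfl
    have e2 : ‖∫ q, Φ q y‖ = ‖(2 * π * c) * (2 * π * c) * (‖g y‖ * (‖f (y - a)‖ * ‖h (y - b)‖))‖ := by
      rw [e1, norm_mul, norm_mul, norm_mul, norm_integral_exp_mul_ft_sub,
        norm_integral_exp_mul_ft_sub, Complex.norm_exp_I_mul_ofReal, RCLike.norm_conj, ← hc,
        Real.norm_of_nonneg (by positivity), neg_sub, neg_sub]
      ring
    rw [← enorm_norm, e2, enorm_norm]
    simp only [enorm_mul, enorm_norm]
  rw [ift2]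
  simp only
  rw [hswap, enorm_mul, enorm_mul]
  have hr : ∀ r : ℝ, ‖(r : ℂ)‖ₑ = ‖r‖ₑ := fun r => by
    rw [← enorm_norm, Complex.norm_real, enorm_norm]
  rw [hr, hr, mul_assoc, mul_assoc]
  gcongr
  refine (enorm_integral_le_lintegral_enorm _).trans (le_of_eq ?_)
  simp_rw [hinner]
  rw [lintegral_const_mul]
  have := f.continuous.measurable
  have := g.continuous.measurable
  have := h.continuous.measurable
  fun_prop

theorem continuous_jb : Continuous jb := by
  unfold jb
  fun_prop

theorem one_le_jb (x : ℝ) : 1 ≤ jb x := by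
  rw [jb, Real.one_le_sqrt]
  nlinarith [sq_nonneg x]

theorem jb_pos (x : ℝ) : 0 < jb x := one_pos.trans_le (one_le_jb x)

theorem abs_le_two_mul_jb_mul_jb_sub (a y : ℝ) : |a| ≤ 2 * (jb y * jb (y - a)) := by
  rw [jb, jb, ← Real.sqrt_mul (by positivity), ← Real.sqrt_sq_eq_abs]
  have h4 : (2:ℝ) = √4 := by
    rw [show (4:ℝ) = 2 ^ 2 by norm_num, Real.sqrt_sq (by norm_num)]
  rw [h4, ← Real.sqrt_mul (by norm_num)]
  apply Real.sqrt_le_sqrt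
  nlinarith [sq_nonneg (y + (y - a)), sq_nonneg (y * (y - a)), sq_nonneg y, sq_nonneg (y - a)]

theorem abs_rpow_le_jb_rpow (a y : ℝ) :
    |a| ^ ((1:ℝ)/5) ≤ 2 * (jb y ^ ((1:ℝ)/5) * jb (y - a) ^ ((2:ℝ)/5)) := by
  have hy := jb_pos y
  have hya := jb_pos (y - a)
  calc |a| ^ ((1:ℝ)/5) ≤ (2 * (jb y * jb (y - a))) ^ ((1:ℝ)/5) :=
        Real.rpow_le_rpow (abs_nonneg _) (abs_le_two_mul_jb_mul_jb_sub a y) (by norm_num)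
    _ = 2 ^ ((1:ℝ)/5) * (jb y ^ ((1:ℝ)/5) * jb (y - a) ^ ((1:ℝ)/5)) := by
        rw [Real.mul_rpow (by norm_num) (by positivity), Real.mul_rpow hy.le hya.le]
    _ ≤ _ := by
        gcongr
        · exact Real.rpow_le_self_of_one_le (by norm_num) (by norm_num)
        · exact one_le_jb _
        · norm_num

theorem abs_rpow_mul_abs_rpow_le (a b y : ℝ) :
    |a| ^ ((1:ℝ)/5) * |b| ^ ((1:ℝ)/5) ≤
      4 * (jb y ^ ((2:ℝ)/5) * (jb (y - a) ^ ((2:ℝ)/5) * jb (y - b) ^ ((2:ℝ)/5))) := by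
  have hy := jb_pos y
  have hya := jb_pos (y - a)
  have hyb := jb_pos (y - b)
  refine (mul_le_mul (abs_rpow_le_jb_rpow a y) (abs_rpow_le_jb_rpow b y) (by positivity)
    (by positivity)).trans (le_of_eq ?_)
  have h : jb y ^ ((2:ℝ)/5) = jb y ^ ((1:ℝ)/5) * jb y ^ ((1:ℝ)/5) := by
    rw [← Real.rpow_add hy]
    norm_num
  rw [h]
  ring

theorem memLp_jb_mul (f : SchwartzMap ℝ ℂ) : MemLp (fun x => (jb x : ℂ) * f x) 2 volume := by
  have hg := Function.hasTemperateGrowth_one_add_norm_sq_rpow ℝ (1 / 2)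
  have h := (SchwartzMap.smulLeftCLM ℂ (fun x : ℝ => (1 + ‖x‖ ^ 2) ^ ((1:ℝ) / 2)) f).memLp 2 volume
  rw [SchwartzMap.smulLeftCLM_apply hg] at h
  convert h using 2 with x
  rw [jb, Real.sqrt_eq_rpow, Complex.real_smul, Real.norm_eq_abs, sq_abs]

/-- Cauchy–Schwarz against a negative power of the Japanese bracket. -/
theorem lintegral_jb_rpow_mul_le : ∃ M : ℝ≥0∞, M ≠ ⊤ ∧ ∀ f : SchwartzMap ℝ ℂ,
    ∫⁻ x, ‖jb x ^ ((2:ℝ)/5)‖ₑ * ‖f x‖ₑ ≤ M * eLpNorm (fun x => (jb x : ℂ) * f x) 2 volume := by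
  refine ⟨(∫⁻ x, ‖jb x ^ (-(3:ℝ)/5)‖ₑ ^ (2:ℝ)) ^ (1 / (2:ℝ)), ?_, fun f => ?_⟩
  · have hint : Integrable (fun x : ℝ => ((1:ℝ) + ‖x‖ ^ 2) ^ (-((6:ℝ)/5) / 2)) volume :=
      integrable_rpow_neg_one_add_norm_sq (by simp; norm_num)
    have heq : ∀ x, ‖jb x ^ (-(3:ℝ)/5)‖ₑ ^ (2:ℝ) = ‖((1:ℝ) + ‖x‖ ^ 2) ^ (-((6:ℝ)/5) / 2)‖ₑ := by
      intro x
      rw [ENNReal.rpow_two, ← enorm_pow, ← Real.rpow_natCast, ← Real.rpow_mul (jb_pos x).le, jb,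
        Real.sqrt_eq_rpow, ← Real.rpow_mul (by positivity), Real.norm_eq_abs, sq_abs]
      norm_num
    simp_rw [heq]
    exact ENNReal.rpow_ne_top_of_nonneg (by norm_num) hint.2.ne
  · have hj := continuous_jb
    have hj0 : ∀ x, jb x ≠ 0 := fun x => (jb_pos x).ne'
    have hf := f.continuous
    have hcs := ENNReal.lintegral_mul_le_Lp_mul_Lq (volume : Measure ℝ)
      Real.HolderConjugate.two_two
      (f := fun x => ‖jb x ^ (-(3:ℝ)/5)‖ₑ) (g := fun x => ‖(jb x : ℂ) * f x‖ₑ)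
      (Continuous.aemeasurable (Continuous.enorm (hj.rpow_const fun x => Or.inl (hj0 x))))
      (Continuous.aemeasurable (by fun_prop))
    rw [eLpNorm_eq_lintegral_rpow_enorm_toReal (by norm_num) (by norm_num)]
    refine le_trans (le_of_eq ?_) (hcs.trans (le_of_eq (by simp)))
    refine lintegral_congr fun x => ?_
    have hr : ‖(jb x : ℂ)‖ₑ = ‖jb x‖ₑ := by
      rw [← enorm_norm, Complex.norm_real, enorm_norm]
    rw [Pi.mul_apply, enorm_mul, hr, ← mul_assoc, ← enorm_mul]
    congr 2
    nth_rewrite 3 [← Real.rpow_one (jb x)]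
    rw [← Real.rpow_add (jb_pos x)]
    norm_num

/-- Tonelli for a trilinear convolution. -/
theorem lintegral_lintegral_lintegral_mul_sub {F G H : ℝ → ℝ≥0∞} (hF : Measurable F)
    (hG : Measurable G) (hH : Measurable H) :
    ∫⁻ a, ∫⁻ b, ∫⁻ y, G y * (F (y - a) * H (y - b)) =
      (∫⁻ y, G y) * ((∫⁻ y, F y) * ∫⁻ y, H y) := by
  have e1 : ∀ a, ∫⁻ b, ∫⁻ y, G y * (F (y - a) * H (y - b)) =
      ∫⁻ y, G y * (F (y - a) * ∫⁻ u, H u) := by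
    intro a
    rw [lintegral_lintegral_swap (Measurable.aemeasurable (by fun_prop))]
    refine lintegral_congr fun y => ?_
    rw [lintegral_const_mul _ (by fun_prop), lintegral_const_mul _ (by fun_prop),
      lintegral_sub_left_eq_self]
  simp_rw [e1]
  rw [lintegral_lintegral_swap (Measurable.aemeasurable (by fun_prop))]
  rw [← lintegral_mul_const _ hG]
  refine lintegral_congr fun y => ?_
  rw [lintegral_const_mul _ (by fun_prop), lintegral_mul_const _ (by fun_prop),
    lintegral_sub_left_eq_self]

/-- trilinear estimate. -/
theorem trilinear_estimate :
    ∃ C : ℝ, 0 < C ∧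
      ∀ f g h : SchwartzMap ℝ ℂ, ∀ ξ : ℝ,
        (∫ η : ℝ, ∫ σ : ℝ,
            |η| ^ ((1:ℝ)/5) * |σ| ^ ((1:ℝ)/5) * ‖ift2 (Gker ⇑f ⇑g ⇑h ξ) (η, σ)‖) ≤
          C * (eLpNorm (fun x => (jb x : ℂ) * f x) 2 volume).toReal *
            (eLpNorm (fun x => (jb x : ℂ) * g x) 2 volume).toReal *
            (eLpNorm (fun x => (jb x : ℂ) * h x) 2 volume).toReal := by
  obtain ⟨K, hK, hker⟩ := enorm_ift2_Gker_le
  obtain ⟨M, hM, hCS⟩ := lintegral_jb_rpow_mul_le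
  refine ⟨(K * 4 * M ^ 3).toReal + 1, by positivity, fun f g h ξ => ?_⟩
  set Nf := eLpNorm (fun x => (jb x : ℂ) * f x) 2 volume
  set Ng := eLpNorm (fun x => (jb x : ℂ) * g x) 2 volume
  set Nh := eLpNorm (fun x => (jb x : ℂ) * h x) 2 volume
  have hNf : Nf ≠ ⊤ := (memLp_jb_mul f).eLpNorm_ne_top
  have hNg : Ng ≠ ⊤ := (memLp_jb_mul g).eLpNorm_ne_top
  have hNh : Nh ≠ ⊤ := (memLp_jb_mul h).eLpNorm_ne_top
  have hmeas : ∀ k : SchwartzMap ℝ ℂ, Measurable fun x => ‖jb x ^ ((2:ℝ)/5)‖ₑ * ‖k x‖ₑ := by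
    intro k
    have hk := k.continuous.measurable
    have hj := continuous_jb.measurable
    fun_prop
  have hpoint : ∀ a b : ℝ,
      ‖|a| ^ ((1:ℝ)/5) * |b| ^ ((1:ℝ)/5) * ‖ift2 (Gker ⇑f ⇑g ⇑h ξ) (a, b)‖‖ₑ ≤
      K * 4 * ∫⁻ y, (‖jb y ^ ((2:ℝ)/5)‖ₑ * ‖g y‖ₑ) *
        ((‖jb (y - a) ^ ((2:ℝ)/5)‖ₑ * ‖f (y - a)‖ₑ) *
          (‖jb (y - b) ^ ((2:ℝ)/5)‖ₑ * ‖h (y - b)‖ₑ)) := by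
    intro a b
    rw [enorm_mul, enorm_norm]
    refine (mul_le_mul_right (hker f g h ξ a b) _).trans ?_
    rw [mul_left_comm, mul_assoc K]
    refine mul_le_mul_right ?_ _
    rw [← lintegral_const_mul' _ _ (by finiteness), ← lintegral_const_mul' _ _ (by finiteness)]
    refine lintegral_mono fun y => ?_
    have hw : ‖|a| ^ ((1:ℝ)/5) * |b| ^ ((1:ℝ)/5)‖ₑ ≤
        4 * (‖jb y ^ ((2:ℝ)/5)‖ₑ * (‖jb (y - a) ^ ((2:ℝ)/5)‖ₑ * ‖jb (y - b) ^ ((2:ℝ)/5)‖ₑ)) := by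
      have h4 : (4 : ℝ≥0∞) = ‖(4:ℝ)‖ₑ := by
        rw [Real.enorm_eq_ofReal (by norm_num)]
        norm_num
      rw [h4, ← enorm_mul, ← enorm_mul, ← enorm_mul, enorm_le_iff_norm_le,
        Real.norm_of_nonneg (by positivity)]
      exact (abs_rpow_mul_abs_rpow_le a b y).trans (Real.le_norm_self _)
    refine (mul_le_mul_left hw _).trans (le_of_eq ?_)
    ring
  have hmain : ‖∫ η : ℝ, ∫ σ : ℝ,
      |η| ^ ((1:ℝ)/5) * |σ| ^ ((1:ℝ)/5) * ‖ift2 (Gker ⇑f ⇑g ⇑h ξ) (η, σ)‖‖ₑ ≤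
      (K * 4 * M ^ 3) * Nf * Ng * Nh := by
    refine (enorm_integral_le_lintegral_enorm _).trans ?_
    refine (lintegral_mono fun a => (enorm_integral_le_lintegral_enorm _).trans
      (lintegral_mono fun b => hpoint a b)).trans ?_
    simp_rw [lintegral_const_mul' (K * 4) _ (by finiteness)]
    rw [lintegral_lintegral_lintegral_mul_sub (hmeas f) (hmeas g) (hmeas h)]
    calc _ ≤ K * 4 * ((M * Ng) * ((M * Nf) * (M * Nh))) := by
          gcongr
          exacts [hCS g, hCS f, hCS h]
      _ = _ := by ring
  have hreal := ENNReal.toReal_mono (by finiteness) hmain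
  rw [toReal_enorm, ENNReal.toReal_mul, ENNReal.toReal_mul, ENNReal.toReal_mul] at hreal
  refine (Real.le_norm_self _).trans (hreal.trans ?_)
  gcongr
  exact le_add_of_nonneg_right zero_le_one
end
end

section
/- For every Schwartz function f on ℝ, every t > 0, and every x ∈ ℝ, the Schrödinger evolution admits the factorization e^{itΔ}f(x) = (2it)^{−1/2} e^{i x²/(4t)} 𝓕( y ↦ e^{i y²/(4t)} f(y) )( x/(2t) ), where (2it)^{−1/2} is taken with the principal branch of the square root. -/
noncomputable section
open MeasureTheory Complex Real Filter Set ENNReal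

/-- The unnormalized Fourier integral is Mathlib's Fourier transform, rescaled. -/
lemma integral_cexp_neg_mul_eq_fourier (f : SchwartzMap ℝ ℂ) (ξ : ℝ) :
    ∫ y : ℝ, cexp (-(I * y * ξ)) * f y = (FourierTransform.fourier f) (ξ / (2 * π)) := by
  rw [SchwartzMap.fourier_coe, Real.fourier_real_eq_integral_exp_smul]
  congr 1 with y
  rw [smul_eq_mul]
  congr 2
  have hpi : (π : ℂ) ≠ 0 := by exact_mod_cast Real.pi_ne_zero
  push_cast
  field_simp

lemma integrable_integral_cexp_neg_mul (f : SchwartzMap ℝ ℂ) :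
    Integrable fun ξ : ℝ => ∫ y : ℝ, cexp (-(I * y * ξ)) * f y := by
  simp_rw [integral_cexp_neg_mul_eq_fourier]
  exact (FourierTransform.fourier f).integrable.comp_div (by positivity)

lemma continuous_integral_cexp_neg_mul (f : SchwartzMap ℝ ℂ) :
    Continuous fun ξ : ℝ => ∫ y : ℝ, cexp (-(I * y * ξ)) * f y := by
  simp_rw [integral_cexp_neg_mul_eq_fourier]
  exact (FourierTransform.fourier f).continuous.comp (by fun_prop)

/-- The inverse Fourier integral of a Gaussian times a Fourier integral is a convolution with the
transformed Gaussian. -/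
lemma integral_gaussian_mul_integral {f : ℝ → ℂ} (hf : Integrable f) {b : ℂ} (hb : 0 < b.re)
    (x : ℝ) :
    ∫ ξ : ℝ, cexp (I * x * ξ) * (cexp (-b * ξ ^ 2) * ∫ y : ℝ, cexp (-(I * y * ξ)) * f y) =
      (π / b) ^ (1 / 2 : ℂ) * ∫ y : ℝ, cexp (-(x - y) ^ 2 / (4 * b)) * f y := by
  have hprod : Integrable (fun p : ℝ × ℝ =>
      cexp (I * (x - p.2) * p.1) * (cexp (-b * p.1 ^ 2) * f p.2))
      (volume.prod volume) := by
    refine ((integrable_cexp_neg_mul_sq hb).mul_prod hf).bdd_mul (c := 1)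
      (Continuous.aestronglyMeasurable (by fun_prop)) (ae_of_all _ fun p => ?_)
    simp [Complex.norm_exp]
  calc
    _ = ∫ ξ : ℝ, ∫ y : ℝ, cexp (I * (x - y) * ξ) * (cexp (-b * ξ ^ 2) * f y) := by
      congr 1 with ξ
      rw [← mul_assoc, ← integral_const_mul]
      congr 1 with y
      rw [show I * (x - y) * ξ = I * x * ξ + -(I * y * ξ) by ring, Complex.exp_add]
      ring
    _ = ∫ y : ℝ, ∫ ξ : ℝ, cexp (I * (x - y) * ξ) * (cexp (-b * ξ ^ 2) * f y) :=
      integral_integral_swap hprod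
    _ = _ := by
      rw [← integral_const_mul]
      congr 1 with y
      simp_rw [← mul_assoc]
      rw [integral_mul_const, fourierIntegral_gaussian hb]

lemma neg_sq_div_re_nonpos (r : ℝ) {b : ℂ} (hb : 0 ≤ b.re) :
    (-(r : ℂ) ^ 2 / (4 * b)).re ≤ 0 := by
  have h : -(r : ℂ) ^ 2 / (4 * b) = ((-(r ^ 2) / 4 : ℝ) : ℂ) * b⁻¹ := by
    push_cast
    rw [div_mul_eq_div_div, div_eq_mul_inv _ b]
  rw [h, Complex.re_ofReal_mul, Complex.inv_re]
  exact mul_nonpos_of_nonpos_of_nonneg (by nlinarith [sq_nonneg r])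
    (div_nonneg hb (Complex.normSq_nonneg b))

/-- `integral_gaussian_mul_integral` on the imaginary axis, as a limit from the right half-plane. -/
lemma integral_cexp_mul_I_mul_integral (f : SchwartzMap ℝ ℂ) {t : ℝ} (ht : 0 < t) (x : ℝ) :
    ∫ ξ : ℝ, cexp (I * x * ξ) *
        (cexp (-(I * t * ξ ^ 2)) * ∫ y : ℝ, cexp (-(I * y * ξ)) * f y) =
      (π / (I * t)) ^ (1 / 2 : ℂ) * ∫ y : ℝ, cexp (-(x - y) ^ 2 / (4 * (I * t))) * f y := by
  have ht' : (t : ℂ) ≠ 0 := by exact_mod_cast ht.ne'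
  have hIt : I * (t : ℂ) ≠ 0 := mul_ne_zero I_ne_zero ht'
  have hb : Tendsto (fun ε : ℝ => (ε : ℂ) + I * t) (nhdsWithin 0 (Ioi 0)) (nhds (I * t)) := by
    have : Continuous fun ε : ℝ => (ε : ℂ) + I * t := by fun_prop
    simpa using (this.tendsto 0).mono_left nhdsWithin_le_nhds
  have hre (ε : ℝ) : ((ε : ℂ) + I * t).re = ε := by simp
  have hpos : ∀ᶠ ε : ℝ in nhdsWithin 0 (Ioi 0), 0 < ε := self_mem_nhdsWithin
  have hleft : Tendsto (fun ε : ℝ => ∫ ξ : ℝ, cexp (I * x * ξ) *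
      (cexp (-((ε : ℂ) + I * t) * ξ ^ 2) * ∫ y : ℝ, cexp (-(I * y * ξ)) * f y))
      (nhdsWithin 0 (Ioi 0)) (nhds (∫ ξ : ℝ, cexp (I * x * ξ) *
        (cexp (-(I * t * ξ ^ 2)) * ∫ y : ℝ, cexp (-(I * y * ξ)) * f y))) := by
    have hcont := continuous_integral_cexp_neg_mul f
    refine tendsto_integral_filter_of_dominated_convergence
      (fun ξ => ‖∫ y : ℝ, cexp (-(I * y * ξ)) * f y‖)
      (Eventually.of_forall fun ε => Continuous.aestronglyMeasurable (by fun_prop)) ?_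
      (integrable_integral_cexp_neg_mul f).norm (ae_of_all _ fun ξ => ?_)
    · filter_upwards [hpos] with ε hε
      refine ae_of_all _ fun ξ => ?_
      rw [norm_mul, norm_mul, ← mul_assoc]
      refine mul_le_of_le_one_left (norm_nonneg _) ?_
      rw [← norm_mul, ← Complex.exp_add, Complex.norm_exp, Real.exp_le_one_iff]
      have : (I * x * ξ + -((ε : ℂ) + I * t) * ξ ^ 2).re = -ε * ξ ^ 2 := by
        simp [← Complex.ofReal_pow]
      rw [this]
      nlinarith [sq_nonneg ξ]
    · refine tendsto_const_nhds.mul (Tendsto.mul_const _ ?_)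
      rw [← neg_mul]
      exact (Complex.continuous_exp.tendsto _).comp (hb.neg.mul_const _)
  have hright : Tendsto (fun ε : ℝ => (π / ((ε : ℂ) + I * t)) ^ (1 / 2 : ℂ) *
      ∫ y : ℝ, cexp (-(x - y) ^ 2 / (4 * ((ε : ℂ) + I * t))) * f y)
      (nhdsWithin 0 (Ioi 0)) (nhds ((π / (I * t)) ^ (1 / 2 : ℂ) *
        ∫ y : ℝ, cexp (-(x - y) ^ 2 / (4 * (I * t))) * f y)) := by
    have hslit : (π : ℂ) / (I * t) ∈ slitPlane := by
      right
      have : (π : ℂ) / (I * t) = ((-(π / t) : ℝ) : ℂ) * I := by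
        push_cast
        field_simp
        simp
      rw [this, Complex.im_ofReal_mul, I_im, mul_one]
      exact neg_ne_zero.mpr (div_pos pi_pos ht).ne'
    refine ((tendsto_const_nhds.div hb hIt).cpow tendsto_const_nhds hslit).mul ?_
    refine tendsto_integral_filter_of_dominated_convergence (fun y => ‖f y‖)
      (Eventually.of_forall fun ε => Continuous.aestronglyMeasurable ?_) ?_
      f.integrable.norm (ae_of_all _ fun y => ?_)
    · have := f.continuous
      fun_prop
    · filter_upwards [hpos] with ε hε
      refine ae_of_all _ fun y => ?_
      rw [norm_mul]
      refine mul_le_of_le_one_left (norm_nonneg _) ?_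
      rw [Complex.norm_exp, Real.exp_le_one_iff]
      have := neg_sq_div_re_nonpos (x - y) (b := (ε : ℂ) + I * t) (by rw [hre]; exact hε.le)
      simpa using this
    · refine Tendsto.mul_const _ ((Complex.continuous_exp.tendsto _).comp ?_)
      exact tendsto_const_nhds.div (hb.const_mul 4) (mul_ne_zero (by norm_num) hIt)
  refine tendsto_nhds_unique (hleft.congr' ?_) hright
  filter_upwards [hpos] with ε hε
  exact integral_gaussian_mul_integral f.integrable (by rw [hre]; exact hε) x

lemma two_pi_rpow_mul_cpow {t : ℝ} (ht : 0 < t) :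
    (((2 * π) ^ (-(1:ℝ)/2) : ℝ) : ℂ) * (π / (I * t)) ^ (1 / 2 : ℂ) =
      (2 * I * t) ^ (-(1:ℂ)/2) := by
  have ht' : (t : ℂ) ≠ 0 := by exact_mod_cast ht.ne'
  have harg : (2 * I * (t : ℂ)).arg ≠ π := by
    rw [show 2 * I * (t : ℂ) = ((2 * t : ℝ) : ℂ) * I by push_cast; ring,
      Complex.arg_real_mul _ (by positivity), Complex.arg_I]
    linarith [pi_pos]
  have hsplit : (π : ℂ) / (I * t) = ((2 * π : ℝ) : ℂ) * (2 * I * t)⁻¹ := by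
    push_cast
    field_simp
  have h2pi : ((2 * π : ℝ) : ℂ) ≠ 0 := by exact_mod_cast (by positivity : (2 * π : ℝ) ≠ 0)
  have hden : 2 * I * (t : ℂ) ≠ 0 := by simp [ht']
  rw [hsplit, Complex.ofReal_cpow (by positivity), Complex.cpow_def_of_ne_zero h2pi,
    Complex.cpow_def_of_ne_zero (mul_ne_zero h2pi (inv_ne_zero hden)),
    Complex.cpow_def_of_ne_zero hden, Complex.log_ofReal_mul (by positivity) (inv_ne_zero hden),
    Complex.log_inv _ harg, Complex.ofReal_log (by positivity), ← Complex.exp_add]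
  congr 1
  push_cast
  ring

/-- the factorization `e^{itΔ} = M(t) D(t) 𝓕 M(t)`. -/
theorem schrodinger_factorization (f : SchwartzMap ℝ ℂ) (t : ℝ) (ht : 0 < t) (x : ℝ) :
    schrodinger t ⇑f x =
      (2 * Complex.I * (t : ℂ)) ^ (-(1:ℂ)/2) *
        Complex.exp (Complex.I * (x : ℂ) ^ 2 / (4 * t)) *
          ft (fun y => Complex.exp (Complex.I * (y : ℂ) ^ 2 / (4 * t)) * f y) (x / (2 * t)) := by
  have ht' : (t : ℂ) ≠ 0 := by exact_mod_cast ht.ne'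
  have hphase : ∫ y : ℝ, cexp (-(x - y) ^ 2 / (4 * (I * t))) * f y =
      cexp (I * (x : ℂ) ^ 2 / (4 * t)) * ∫ y : ℝ, cexp (-(I * y * (x / (2 * t) : ℝ))) *
        (cexp (I * (y : ℂ) ^ 2 / (4 * t)) * f y) := by
    rw [← integral_const_mul]
    congr 1 with y
    rw [← mul_assoc (cexp _) (cexp _) (f y), ← mul_assoc (cexp _) _ (f y), ← Complex.exp_add,
      ← Complex.exp_add]
    congr 2
    push_cast
    field_simp
    rw [I_sq]
    ring
  simp only [schrodinger, ift, ft]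
  simp_rw [mul_left_comm _ (((2 * π) ^ (-(1:ℝ)/2) : ℝ) : ℂ)]
  rw [integral_const_mul, integral_cexp_mul_I_mul_integral f ht x, hphase,
    ← two_pi_rpow_mul_cpow ht]
  ring
end
end

section
/- For every Schwartz function φ on ℝ there is a constant C = C(φ) such that ‖e^{itΔ}φ‖_{L^8(ℝ)} ≤ C (1+|t|)^{−3/8} for all t ∈ ℝ. -/
noncomputable section
open MeasureTheory Complex Real Filter Set ENNReal

open scoped SchwartzMap FourierTransform

/-- The oscillatory integral `∫ e^{ixξ} e^{-itξ²} ψ(ξ) dξ`. -/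
def oscInt (t : ℝ) (ψ : ℝ → ℂ) (x : ℝ) : ℂ :=
  ∫ ξ : ℝ, Complex.exp (Complex.I * x * ξ) * (Complex.exp (-(Complex.I * t * ξ ^ 2)) * ψ ξ)

lemma norm_exp_I_mul_mul (x ξ : ℝ) : ‖Complex.exp (Complex.I * x * ξ)‖ = 1 := by
  rw [Complex.norm_exp]; simp

lemma norm_exp_neg_I_mul_sq (t ξ : ℝ) : ‖Complex.exp (-(Complex.I * t * ξ ^ 2))‖ = 1 := by
  rw [Complex.norm_exp, ← Complex.ofReal_pow]; simp [-Complex.ofReal_pow]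

lemma norm_oscInt_le_integral (t : ℝ) (ψ : ℝ → ℂ) (x : ℝ) :
    ‖oscInt t ψ x‖ ≤ ∫ ξ, ‖ψ ξ‖ := by
  refine (norm_integral_le_integral_norm _).trans_eq ?_
  simp only [norm_mul, norm_exp_I_mul_mul, norm_exp_neg_I_mul_sq, one_mul]

lemma norm_integral_exp_mul_gaussian_le {b : ℂ} (hb : 0 < b.re) (y : ℝ) :
    ‖∫ ξ : ℝ, Complex.exp (Complex.I * y * ξ) * Complex.exp (-b * ξ ^ 2)‖ ≤ √(π / ‖b‖) := by
  rw [fourierIntegral_gaussian hb]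
  have h1 : ‖((π : ℂ) / b) ^ (1 / 2 : ℂ)‖ = √(π / ‖b‖) := by
    rw [show (1 / 2 : ℂ) = ((1 / 2 : ℝ) : ℂ) by push_cast; rfl, Complex.norm_cpow_real,
      norm_div, Complex.norm_real, Real.norm_of_nonneg pi_pos.le, Real.sqrt_eq_rpow]
  have h2 : ‖Complex.exp (-(y : ℂ) ^ 2 / (4 * b))‖ ≤ 1 := by
    rw [Complex.norm_exp, Real.exp_le_one_iff,
      show -(y : ℂ) ^ 2 / (4 * b) = ((-(y ^ 2 / 4) : ℝ) : ℂ) * b⁻¹ by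
        push_cast; rw [mul_comm (4 : ℂ) b, div_mul_eq_div_div]; ring,
      Complex.re_ofReal_mul, Complex.inv_re]
    have : 0 ≤ b.re / Complex.normSq b := div_nonneg hb.le (Complex.normSq_nonneg b)
    nlinarith [sq_nonneg y]
  rw [norm_mul, h1]
  exact mul_le_of_le_one_right (Real.sqrt_nonneg _) h2

lemma norm_integral_gaussian_mul_fourier_le (g : 𝓢(ℝ, ℂ)) {b : ℂ} (hb : 0 < b.re) (x : ℝ) :
    ‖∫ ξ : ℝ, Complex.exp (Complex.I * x * ξ) * (Complex.exp (-b * ξ ^ 2) * 𝓕 (g : ℝ → ℂ) ξ)‖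
      ≤ √(π / ‖b‖) * ∫ v, ‖g v‖ := by
  have hint : Integrable (Function.uncurry fun ξ v : ℝ =>
      Complex.exp (Complex.I * (x - 2 * π * v : ℝ) * ξ) * (Complex.exp (-b * ξ ^ 2) * g v))
      (volume.prod volume) := by
    refine ((integrable_cexp_neg_mul_sq hb).mul_prod g.integrable).bdd_mul (c := 1) ?_ ?_
    · exact Continuous.aestronglyMeasurable (by fun_prop)
    · exact Eventually.of_forall fun z => (norm_exp_I_mul_mul _ _).le
  have hswap : ∫ ξ : ℝ, Complex.exp (Complex.I * x * ξ) *
        (Complex.exp (-b * ξ ^ 2) * 𝓕 (g : ℝ → ℂ) ξ) =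
      ∫ v : ℝ, (∫ ξ : ℝ, Complex.exp (Complex.I * (x - 2 * π * v : ℝ) * ξ) *
        Complex.exp (-b * ξ ^ 2)) * g v := by
    calc _ = ∫ ξ : ℝ, ∫ v : ℝ, Complex.exp (Complex.I * (x - 2 * π * v : ℝ) * ξ) *
          (Complex.exp (-b * ξ ^ 2) * g v) := by
          refine integral_congr_ae (Eventually.of_forall fun ξ => ?_)
          simp only [Real.fourier_real_eq_integral_exp_smul, ← integral_const_mul]
          refine integral_congr_ae (Eventually.of_forall fun v => ?_)
          simp only [smul_eq_mul]
          rw [show Complex.I * ((x - 2 * π * v : ℝ) : ℂ) * ξ =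
            Complex.I * x * ξ + ((-2 * π * v * ξ : ℝ) : ℂ) * Complex.I by push_cast; ring,
            Complex.exp_add]
          ring
      _ = ∫ v : ℝ, ∫ ξ : ℝ, Complex.exp (Complex.I * (x - 2 * π * v : ℝ) * ξ) *
          (Complex.exp (-b * ξ ^ 2) * g v) := integral_integral_swap hint
      _ = _ := by simp only [← mul_assoc, integral_mul_const]
  rw [hswap, ← integral_const_mul]
  refine norm_integral_le_of_norm_le (g.integrable.norm.const_mul _)
    (Eventually.of_forall fun v => ?_)
  rw [norm_mul]
  gcongr
  exact norm_integral_exp_mul_gaussian_le hb _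

/-- Dispersive estimate, obtained from Gaussian regularisation. -/
lemma norm_oscInt_fourier_le (g : 𝓢(ℝ, ℂ)) {t : ℝ} (ht : t ≠ 0) (x : ℝ) :
    ‖oscInt t (𝓕 g : 𝓢(ℝ, ℂ)) x‖ ≤ √(π / |t|) * ∫ v, ‖g v‖ := by
  have hb : Tendsto (fun ε : ℝ => (ε : ℂ) + Complex.I * t) (nhdsWithin 0 (Ioi 0))
      (nhds (Complex.I * t)) := by
    have : Continuous fun ε : ℝ => (ε : ℂ) + Complex.I * t := by fun_prop
    simpa using (this.tendsto 0).mono_left nhdsWithin_le_nhds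
  have hlim : Tendsto (fun ε : ℝ => ∫ ξ : ℝ, Complex.exp (Complex.I * x * ξ) *
      (Complex.exp (-((ε : ℂ) + Complex.I * t) * ξ ^ 2) * (𝓕 g) ξ)) (nhdsWithin 0 (Ioi 0))
      (nhds (oscInt t (𝓕 g : 𝓢(ℝ, ℂ)) x)) := by
    refine tendsto_integral_filter_of_dominated_convergence (fun ξ => ‖(𝓕 g) ξ‖) ?_ ?_
      (𝓕 g).integrable.norm ?_
    · exact Eventually.of_forall fun ε => Continuous.aestronglyMeasurable (by fun_prop)
    · filter_upwards [self_mem_nhdsWithin] with ε hε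
      refine Eventually.of_forall fun ξ => ?_
      rw [norm_mul, norm_mul, norm_exp_I_mul_mul, one_mul]
      refine mul_le_of_le_one_left (norm_nonneg _) ?_
      rw [Complex.norm_exp, Real.exp_le_one_iff, ← Complex.ofReal_pow, Complex.re_mul_ofReal]
      simp only [Complex.neg_re, Complex.add_re, Complex.ofReal_re, Complex.re_mul_ofReal,
        Complex.I_re, zero_mul, add_zero]
      nlinarith [sq_nonneg ξ, mem_Ioi.mp hε]
    · refine Eventually.of_forall fun ξ => ?_
      have : Continuous fun z : ℂ => Complex.exp (Complex.I * x * ξ) *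
        (Complex.exp (-z * ξ ^ 2) * (𝓕 g) ξ) := by fun_prop
      simpa only [Function.comp_def, neg_mul] using (this.tendsto _).comp hb
  have hR : Tendsto (fun ε : ℝ => √(π / ‖(ε : ℂ) + Complex.I * t‖) * ∫ v, ‖g v‖)
      (nhdsWithin 0 (Ioi 0)) (nhds (√(π / |t|) * ∫ v, ‖g v‖)) := by
    refine Tendsto.mul_const _ ?_
    refine (Real.continuous_sqrt.tendsto _).comp (tendsto_const_nhds.div ?_ (abs_ne_zero.mpr ht))
    simpa using hb.norm
  refine le_of_tendsto_of_tendsto hlim.norm hR ?_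
  filter_upwards [self_mem_nhdsWithin] with ε hε
  refine norm_integral_gaussian_mul_fourier_le g ?_ x
  simpa using hε

lemma exists_norm_oscInt_le (ψ : 𝓢(ℝ, ℂ)) :
    ∃ C : ℝ, 0 ≤ C ∧ ∀ t x : ℝ, ‖oscInt t ψ x‖ ≤ C / √(1 + |t|) := by
  set A := ∫ ξ, ‖ψ ξ‖
  set B := ∫ v, ‖(𝓕⁻ ψ) v‖
  refine ⟨√(A ^ 2 + π * B ^ 2), Real.sqrt_nonneg _, fun t x => ?_⟩
  have hA : ‖oscInt t ψ x‖ ^ 2 ≤ A ^ 2 := by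
    gcongr
    exact norm_oscInt_le_integral t ψ x
  have hB : |t| * ‖oscInt t ψ x‖ ^ 2 ≤ π * B ^ 2 := by
    rcases eq_or_ne t 0 with rfl | ht
    · simp only [abs_zero, zero_mul]; positivity
    have h := norm_oscInt_fourier_le (𝓕⁻ ψ) ht x
    rw [FourierTransform.fourier_fourierInv_eq] at h
    have ht' : 0 < |t| := abs_pos.mpr ht
    calc |t| * ‖oscInt t ψ x‖ ^ 2 ≤ |t| * (√(π / |t|) * B) ^ 2 := by gcongr
      _ = π * B ^ 2 := by
        rw [mul_pow, Real.sq_sqrt (by positivity)]; field_simp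
  rw [← Real.sqrt_div (by positivity)]
  refine Real.le_sqrt_of_sq_le ?_
  rw [le_div_iff₀ (by positivity)]
  linarith

/-- Integration by parts: multiplication by `x` on the physical side. -/
lemma mul_oscInt (ψ : 𝓢(ℝ, ℂ)) (t x : ℝ) :
    (x : ℂ) * oscInt t ψ x = Complex.I * oscInt t (SchwartzMap.derivCLM ℂ ℂ ψ) x +
      2 * t * oscInt t (SchwartzMap.smulLeftCLM ℂ (fun ξ : ℝ => (ξ : ℂ)) ψ) x := by
  set χ := SchwartzMap.smulLeftCLM ℂ (fun ξ : ℝ => (ξ : ℂ)) ψ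
  have hχ : ∀ ξ : ℝ, χ ξ = ξ * ψ ξ := fun ξ =>
    SchwartzMap.smulLeftCLM_apply_apply (Complex.ofRealCLM.hasTemperateGrowth) ψ ξ
  set e : ℝ → ℂ := fun ξ =>
    Complex.exp (Complex.I * x * ξ) * Complex.exp (-(Complex.I * t * ξ ^ 2)) with he
  have he1 : ∀ ξ, ‖e ξ‖ ≤ 1 := fun ξ => by
    rw [he, norm_mul, norm_exp_I_mul_mul, norm_exp_neg_I_mul_sq, one_mul]
  have hec : Continuous e := by fun_prop
  have hint : ∀ f : 𝓢(ℝ, ℂ), Integrable fun ξ => e ξ * f ξ := fun f =>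
    f.integrable.bdd_mul (c := 1) hec.aestronglyMeasurable (Eventually.of_forall he1)
  have hosc : ∀ f : 𝓢(ℝ, ℂ), oscInt t f x = ∫ ξ, e ξ * f ξ := fun f => by
    simp only [oscInt, he, mul_assoc]
  have hde : ∀ ξ : ℝ, HasDerivAt e ((Complex.I * x - 2 * Complex.I * t * ξ) * e ξ) ξ := by
    intro ξ
    have h0 : HasDerivAt (fun ξ : ℝ => (ξ : ℂ)) 1 ξ := Complex.ofRealCLM.hasDerivAt
    have h1 := (h0.const_mul (Complex.I * x)).cexp
    have h2 : HasDerivAt (fun ξ : ℝ => Complex.exp (-(Complex.I * t * ξ ^ 2))) _ ξ :=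
      ((h0.pow 2).const_mul (Complex.I * t)).neg.cexp
    refine (h1.mul h2).congr_deriv ?_
    simp only [he, Nat.cast_ofNat, Nat.add_one_sub_one, pow_one, Pi.neg_apply, Pi.pow_apply]
    ring
  have hparts := integral_mul_deriv_eq_deriv_mul_of_integrable (u := e) (v := ψ)
    (v' := SchwartzMap.derivCLM ℂ ℂ ψ) (fun ξ _ => hde ξ)
    (fun ξ _ => ψ.differentiableAt.hasDerivAt) (hint _)
    ((((hint ψ).const_mul (Complex.I * x)).sub ((hint χ).const_mul (2 * Complex.I * t))).congr
      (Eventually.of_forall fun ξ => by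
        simp only [Pi.sub_apply, Pi.mul_apply, hχ]; ring)) (hint ψ)
  have hsum : ∫ ξ : ℝ, (Complex.I * x - 2 * Complex.I * t * ξ) * e ξ * ψ ξ =
      Complex.I * x * oscInt t ψ x - 2 * Complex.I * t * oscInt t χ x := by
    rw [hosc, hosc, ← integral_const_mul, ← integral_const_mul,
      ← integral_sub ((hint ψ).const_mul _) ((hint χ).const_mul _)]
    refine integral_congr_ae (Eventually.of_forall fun ξ => ?_)
    simp only [hχ]; ring
  rw [hsum, ← hosc] at hparts
  rw [hparts]
  linear_combination ((x : ℂ) * oscInt t ψ x - 2 * t * oscInt t χ x) * Complex.I_sq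

/-- The frequency profile `ft φ` of a Schwartz function is a Schwartz function. -/
lemma exists_schwartzMap_eq_ft (φ : 𝓢(ℝ, ℂ)) : ∃ ψ : 𝓢(ℝ, ℂ), ft φ = ψ := by
  have hπ : (2 * π)⁻¹ ≠ 0 := by positivity
  refine ⟨(((2 * π) ^ (-(1:ℝ)/2) : ℝ) : ℂ) • SchwartzMap.compCLMOfContinuousLinearEquiv ℂ
    (ContinuousLinearEquiv.unitsEquivAut ℝ (Units.mk0 _ hπ)) (𝓕 φ), ?_⟩
  ext ξ
  simp only [ft, smul_apply, SchwartzMap.compCLMOfContinuousLinearEquiv_apply,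
    Function.comp_apply, smul_eq_mul, ContinuousLinearEquiv.unitsEquivAut_apply, Units.val_mk0,
    SchwartzMap.fourier_coe, Real.fourier_real_eq_integral_exp_smul]
  congr 2
  ext v
  congr 2
  push_cast
  field_simp

lemma exists_schrodinger_pointwise_bound (φ : 𝓢(ℝ, ℂ)) :
    ∃ A : ℝ, 0 < A ∧ ∀ t x : ℝ, ‖schrodinger t φ x‖ ≤ A / √(1 + |t|) ∧
      |x / (1 + |t|)| * ‖schrodinger t φ x‖ ≤ A / √(1 + |t|) := by
  obtain ⟨ψ, hψ⟩ := exists_schwartzMap_eq_ft φ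
  obtain ⟨C₀, h₀, H₀⟩ := exists_norm_oscInt_le ψ
  obtain ⟨C₁, h₁, H₁⟩ := exists_norm_oscInt_le (SchwartzMap.derivCLM ℂ ℂ ψ)
  obtain ⟨C₂, h₂, H₂⟩ :=
    exists_norm_oscInt_le (SchwartzMap.smulLeftCLM ℂ (fun ξ : ℝ => (ξ : ℂ)) ψ)
  set c : ℝ := (2 * π) ^ (-(1:ℝ)/2)
  have hc : 0 < c := by positivity
  have hS : ∀ t x, ‖schrodinger t φ x‖ = c * ‖oscInt t ψ x‖ := fun t x => by
    rw [← hψ, ← Real.norm_of_nonneg hc.le, ← Complex.norm_real, ← norm_mul]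
    rfl
  refine ⟨c * (C₀ + C₁ + 2 * C₂ + 1), by positivity, fun t x => ?_⟩
  have hs : 0 < 1 + |t| := by positivity
  have hr : 0 < √(1 + |t|) := Real.sqrt_pos.mpr hs
  rw [hS]
  constructor
  · rw [mul_div_assoc]
    gcongr
    refine (H₀ t x).trans ?_
    gcongr
    linarith
  · have hx : |x| * ‖oscInt t ψ x‖ ≤ (1 + |t|) * ((C₁ + 2 * C₂) / √(1 + |t|)) := by
      rw [← Real.norm_eq_abs, ← Complex.norm_real, ← norm_mul, mul_oscInt]
      refine (norm_add_le _ _).trans ?_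
      rw [norm_mul, norm_mul, norm_mul, Complex.norm_I, one_mul, Complex.norm_real,
        Real.norm_eq_abs, Complex.norm_ofNat]
      calc _ ≤ C₁ / √(1 + |t|) + 2 * |t| * (C₂ / √(1 + |t|)) := by
            gcongr
            · exact H₁ t x
            · exact H₂ t x
        _ ≤ (1 + |t|) * (C₁ / √(1 + |t|)) + (1 + |t|) * (2 * (C₂ / √(1 + |t|))) := by
            have e1 : 0 ≤ C₁ / √(1 + |t|) := by positivity
            have e2 : 0 ≤ C₂ / √(1 + |t|) := by positivity
            nlinarith [mul_nonneg (abs_nonneg t) e1]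
        _ = _ := by ring
    rw [abs_div, abs_of_pos hs]
    calc |x| / (1 + |t|) * (c * ‖oscInt t ψ x‖)
        = c * (|x| * ‖oscInt t ψ x‖) / (1 + |t|) := by ring
      _ ≤ c * ((1 + |t|) * ((C₁ + 2 * C₂) / √(1 + |t|))) / (1 + |t|) := by gcongr
      _ = c * (C₁ + 2 * C₂) / √(1 + |t|) := by field_simp
      _ ≤ _ := by
        gcongr c * ?_ / _
        linarith

/-- An `L⁸` bound for a function of size `M` concentrated on the scale `s`. -/
lemma eLpNorm_eight_le_of_concentrated {f : ℝ → ℂ} {M s : ℝ} (hs : 0 < s)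
    (h₁ : ∀ x, ‖f x‖ ≤ M) (h₂ : ∀ x, |x / s| * ‖f x‖ ≤ M) :
    eLpNorm f 8 volume ≤ ENNReal.ofReal ((2 * M ^ 8 * (s * π)) ^ (1 / 8 : ℝ)) := by
  have hM : 0 ≤ M := (norm_nonneg _).trans (h₁ 0)
  have hpt : ∀ x, ‖f x‖ ^ 8 ≤ 2 * M ^ 8 * (1 + (x / s) ^ 2)⁻¹ := by
    intro x
    rw [← div_eq_mul_inv, le_div_iff₀ (by positivity)]
    have e1 : ‖f x‖ ^ 8 ≤ M ^ 8 := by gcongr; exact h₁ x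
    have e2 : ‖f x‖ ^ 6 * (|x / s| * ‖f x‖) ^ 2 ≤ M ^ 6 * M ^ 2 := by
      gcongr
      · exact h₁ x
      · exact h₂ x
    rw [mul_pow, sq_abs] at e2
    linarith
  have hI : Integrable fun x : ℝ => 2 * M ^ 8 * (1 + (x / s) ^ 2)⁻¹ :=
    (integrable_inv_one_add_sq.comp_div hs.ne').const_mul _
  rw [eLpNorm_eq_lintegral_rpow_enorm_toReal (by norm_num) (by norm_num), ENNReal.toReal_ofNat,
    ← ENNReal.ofReal_rpow_of_nonneg (by positivity) (by norm_num)]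
  gcongr
  calc ∫⁻ x, ‖f x‖ₑ ^ (8 : ℝ) ≤ ∫⁻ x, ENNReal.ofReal (2 * M ^ 8 * (1 + (x / s) ^ 2)⁻¹) := by
        refine lintegral_mono fun x => ?_
        rw [← ofReal_norm, ENNReal.ofReal_rpow_of_nonneg (norm_nonneg _) (by norm_num)]
        exact ENNReal.ofReal_le_ofReal (by exact_mod_cast hpt x)
    _ = ENNReal.ofReal (2 * M ^ 8 * (s * π)) := by
        rw [← ofReal_integral_eq_lintegral_ofReal hI
          (Eventually.of_forall fun x => by positivity), integral_const_mul,
          Measure.integral_comp_div (fun y : ℝ => (1 + y ^ 2)⁻¹), integral_univ_inv_one_add_sq,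
          abs_of_pos hs, smul_eq_mul]

/-- `L⁸` decay of the free evolution of a Schwartz function. -/
theorem L8_decay (φ : SchwartzMap ℝ ℂ) :
    ∃ C : ℝ, 0 < C ∧
      ∀ t : ℝ,
        eLpNorm (schrodinger t ⇑φ) 8 volume ≤
          ENNReal.ofReal (C * (1 + |t|) ^ (-(3:ℝ)/8)) := by
  obtain ⟨A, hA, H⟩ := exists_schrodinger_pointwise_bound φ
  refine ⟨(2 * A ^ 8 * π) ^ (1 / 8 : ℝ), by positivity, fun t => ?_⟩
  have hs : 0 < 1 + |t| := by positivity
  refine (eLpNorm_eight_le_of_concentrated hs (fun x => (H t x).1) fun x => (H t x).2).trans_eq ?_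
  congr 1
  have h4 : √(1 + |t|) ^ 8 = (1 + |t|) ^ 4 := by
    rw [show 8 = 2 * 4 from rfl, pow_mul, Real.sq_sqrt hs.le]
  have hM : 2 * (A / √(1 + |t|)) ^ 8 * ((1 + |t|) * π) =
      2 * A ^ 8 * π * (1 + |t|) ^ (-3 : ℝ) := by
    rw [div_pow, h4, Real.rpow_neg hs.le, show (3 : ℝ) = (3 : ℕ) by norm_num, Real.rpow_natCast]
    field_simp
  rw [hM, Real.mul_rpow (by positivity) (by positivity), ← Real.rpow_mul hs.le]
  norm_num
end
end
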